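/- Fix integers k ≥ 2 and d ≥ 2 and a real ε > 0. Then there exists a constant c > 0 (depending only on k, d, ε) such that the following holds: if C_1, …, C_M are M = ⌈2^{c·n}⌉ independent uniformly random strings in [k]^n, then the probability that there exist indices i_1 < i_2 < ⋯ < i_d with LCS(C_{i_1}, …, C_{i_d}) > E[LCS(X^1, …, X^d)] + ε·n tends to 0 as n → ∞, where X^1, …, X^d are independent uniformly random strings in [k]^n. (In particular, for every ε > 0 a random code of rate c is, with high probability, (p, d−1) list-decodable against deletions for p = 1 − E[LCS]/n − ε.) -/

import Mathlib

/-- The length of the longest common subsequence of the `d` strings `X 0, …, X (d-1)`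
over the alphabet `Fin k`. -/
noncomputable def lcsLen {k : ℕ} (d : ℕ) (X : Fin d → List (Fin k)) : ℕ :=
  sSup {m : ℕ | ∃ w : List (Fin k), w.length = m ∧ ∀ i : Fin d, w.Sublist (X i)}

/-- `expLCS k d n` is the expected LCS length of `d` independent uniformly random strings
of length `n` over an alphabet of size `k`. -/
noncomputable def expLCS (k d n : ℕ) : ℝ :=
  (∑ X : Fin d → Fin n → Fin k, (lcsLen d (fun i => List.ofFn (X i)) : ℝ)) /
    (Fintype.card (Fin d → Fin n → Fin k) : ℝ)

theorem List.Sublist.exists_sublist_eraseIdx {α : Type*} {w L : List α} (h : w.Sublist L) (t : ℕ) :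
    ∃ w' : List α, w'.Sublist w ∧ w'.Sublist (L.eraseIdx t) ∧ w.length ≤ w'.length + 1 := by
  induction h generalizing t with
  | slnil => exact ⟨[], by simp⟩
  | @cons l₁ l₂ a h ih =>
    cases t with
    | zero => exact ⟨l₁, List.Sublist.refl _, by simpa using h, by omega⟩
    | succ t =>
      obtain ⟨w', h₁, h₂, h₃⟩ := ih t
      exact ⟨w', h₁, by simpa using h₂.cons a, h₃⟩
  | @cons_cons l₁ l₂ a h ih =>
    cases t with
    | zero => exact ⟨l₁, List.sublist_cons_self _ _, by simpa using h, by simp⟩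
    | succ t =>
      obtain ⟨w', h₁, h₂, h₃⟩ := ih t
      exact ⟨a :: w', h₁.cons_cons a, by simpa using h₂.cons_cons a, by simpa using h₃⟩

theorem lcsLen_bddAbove {k d : ℕ} (hd : 0 < d) (X : Fin d → List (Fin k)) :
    BddAbove {m : ℕ | ∃ w : List (Fin k), w.length = m ∧ ∀ i : Fin d, w.Sublist (X i)} := by
  refine ⟨(X ⟨0, hd⟩).length, ?_⟩
  rintro m ⟨w, rfl, hw⟩
  exact (hw _).length_le

theorem le_lcsLen {k d : ℕ} (hd : 0 < d) {X : Fin d → List (Fin k)} {w : List (Fin k)}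
    (hw : ∀ i, w.Sublist (X i)) : w.length ≤ lcsLen d X :=
  le_csSup (lcsLen_bddAbove hd X) ⟨w, rfl, hw⟩

theorem exists_length_eq_lcsLen {k d : ℕ} (hd : 0 < d) (X : Fin d → List (Fin k)) :
    ∃ w : List (Fin k), w.length = lcsLen d X ∧ ∀ i, w.Sublist (X i) :=
  Nat.sSup_mem (s := {m : ℕ | ∃ w : List (Fin k), w.length = m ∧ ∀ i : Fin d, w.Sublist (X i)})
    ⟨0, [], rfl, fun _ => List.nil_sublist _⟩ (lcsLen_bddAbove hd X)

theorem lcsLen_le_add_one {k d : ℕ} (hd : 0 < d) {X Y : Fin d → List (Fin k)} (i : Fin d) (t : ℕ)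
    (hi : (X i).eraseIdx t = (Y i).eraseIdx t) (hne : ∀ j, j ≠ i → X j = Y j) :
    lcsLen d X ≤ lcsLen d Y + 1 := by
  obtain ⟨w, hw, hX⟩ := exists_length_eq_lcsLen hd X
  obtain ⟨w', h₁, h₂, h₃⟩ := (hX i).exists_sublist_eraseIdx t
  have : w'.length ≤ lcsLen d Y := by
    refine le_lcsLen hd fun j => ?_
    by_cases hj : j = i
    · subst hj
      exact (hi ▸ h₂).trans (List.eraseIdx_sublist _ _)
    · exact hne j hj ▸ h₁.trans (hX j)
  omega

theorem List.eraseIdx_ofFn_congr {α : Type*} {n : ℕ} {x y : Fin n → α} (t : Fin n)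
    (h : ∀ s, s ≠ t → x s = y s) :
    (List.ofFn x).eraseIdx t = (List.ofFn y).eraseIdx t := by
  apply List.ext_getElem
  · simp [List.length_eraseIdx]
  · intro m h₁ h₂
    simp only [List.getElem_eraseIdx, List.getElem_ofFn]
    split_ifs with hm
    · exact h _ (by simp [Fin.ext_iff]; omega)
    · exact h _ (by simp [Fin.ext_iff]; omega)

theorem exp_mul_le_cosh_add_mul_sinh {s y : ℝ} (hy : |y| ≤ 1) :
    Real.exp (s * y) ≤ Real.cosh s + y * Real.sinh s := by
  obtain ⟨h₁, h₂⟩ := abs_le.mp hy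
  have h := convexOn_exp.2 (Set.mem_univ s) (Set.mem_univ (-s))
    (show 0 ≤ (1 + y) / 2 by linarith) (show 0 ≤ (1 - y) / 2 by linarith) (by ring)
  simp only [smul_eq_mul] at h
  rw [Real.cosh_eq, Real.sinh_eq]
  calc Real.exp (s * y) = Real.exp ((1 + y) / 2 * s + (1 - y) / 2 * -s) := by ring_nf
    _ ≤ _ := h
    _ = _ := by ring

open Finset in
/-- A bounded-range form of Hoeffding's lemma for the uniform distribution on a finite type. -/
theorem sum_exp_mul_sub_mean_le {α : Type*} [Fintype α] [Nonempty α] (g : α → ℝ)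
    (hg : ∀ a b, g a - g b ≤ 1) (s : ℝ) :
    ∑ a, Real.exp (s * (g a - (∑ b, g b) / Fintype.card α)) ≤
      Fintype.card α * Real.exp (s ^ 2 / 2) := by
  have hc : (0 : ℝ) < Fintype.card α := by exact_mod_cast Fintype.card_pos
  set μ := (∑ b, g b) / Fintype.card α with hμ
  have hsum : ∑ b, g b = Fintype.card α * μ := by rw [hμ]; field_simp
  have hle : ∀ a, |g a - μ| ≤ 1 := by
    intro a
    have h₁ : ∑ b, (g a - g b) ≤ ∑ _b : α, (1 : ℝ) := sum_le_sum fun b _ => hg a b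
    have h₂ : ∑ b, (g b - g a) ≤ ∑ _b : α, (1 : ℝ) := sum_le_sum fun b _ => hg b a
    simp only [sum_sub_distrib, sum_const, card_univ, nsmul_eq_mul, hsum, mul_one] at h₁ h₂
    rw [abs_le]
    constructor
    · nlinarith
    · nlinarith
  have hzero : ∑ a, (g a - μ) = 0 := by
    simp [sum_sub_distrib, hsum]
  calc ∑ a, Real.exp (s * (g a - μ))
      ≤ ∑ a, (Real.cosh s + (g a - μ) * Real.sinh s) :=
        sum_le_sum fun a _ => exp_mul_le_cosh_add_mul_sinh (hle a)
    _ = Fintype.card α * Real.cosh s := by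
        rw [sum_add_distrib, ← sum_mul, hzero]; simp
    _ ≤ _ := by gcongr; exact Real.cosh_le_exp_half_sq s

open Finset in
theorem sum_exp_mul_sub_mean_le_of_bounded_differences_fin {α : Type*} [Fintype α] [Nonempty α]
    (s : ℝ) (N : ℕ) (f : (Fin N → α) → ℝ)
    (hf : ∀ x y i, (∀ j, j ≠ i → x j = y j) → f x - f y ≤ 1) :
    ∑ x, Real.exp (s * (f x - (∑ y, f y) / Fintype.card (Fin N → α))) ≤
      Fintype.card (Fin N → α) * Real.exp (N * (s ^ 2 / 2)) := by
  induction N with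
  | zero => simp
  | succ N ih =>
    have hc : (0 : ℝ) < Fintype.card α := by exact_mod_cast Fintype.card_pos
    have hcN : (0 : ℝ) < Fintype.card (Fin N → α) := by exact_mod_cast Fintype.card_pos
    have hsplit : ∀ F : (Fin (N + 1) → α) → ℝ,
        ∑ x, F x = ∑ a, ∑ x : Fin N → α, F (Fin.cons a x) := fun F => by
      rw [← (Fin.consEquiv fun _ => α).sum_comp, Fintype.sum_prod_type]
      rfl
    set g : α → ℝ := fun a => (∑ x : Fin N → α, f (Fin.cons a x)) / Fintype.card (Fin N → α)
      with hgdef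
    have hcard : (Fintype.card (Fin (N + 1) → α) : ℝ) =
        Fintype.card α * Fintype.card (Fin N → α) := by
      simp [pow_succ, mul_comm]
    have hmean : (∑ y, f y) / Fintype.card (Fin (N + 1) → α) = (∑ a, g a) / Fintype.card α := by
      rw [hsplit, hcard, hgdef, ← sum_div, div_div, mul_comm (Fintype.card α : ℝ)]
    have hg : ∀ a b, g a - g b ≤ 1 := by
      intro a b
      rw [hgdef, ← sub_div, ← sum_sub_distrib, div_le_one hcN]
      calc _ ≤ ∑ _x : Fin N → α, (1 : ℝ) := sum_le_sum fun x _ => hf _ _ 0 fun j hj => by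
            obtain ⟨j, rfl⟩ := Fin.exists_succ_eq.mpr hj
            simp
        _ = _ := by simp
    have hinner : ∀ a, ∑ x : Fin N → α, Real.exp (s * (f (Fin.cons a x) - g a)) ≤
        Fintype.card (Fin N → α) * Real.exp (N * (s ^ 2 / 2)) := fun a =>
      ih (fun x => f (Fin.cons a x)) fun x y i hxy => hf _ _ i.succ fun j hj => by
        cases j using Fin.cases with
        | zero => simp
        | succ j => simpa using hxy j fun h => hj (h ▸ rfl)
    rw [hmean, hsplit, hcard]
    set μ := (∑ a, g a) / Fintype.card α with hμ
    calc ∑ a, ∑ x : Fin N → α, Real.exp (s * (f (Fin.cons a x) - μ))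
        = ∑ a, Real.exp (s * (g a - μ)) *
            ∑ x : Fin N → α, Real.exp (s * (f (Fin.cons a x) - g a)) := by
          refine sum_congr rfl fun a _ => ?_
          rw [mul_sum]
          refine sum_congr rfl fun x _ => ?_
          rw [← Real.exp_add]
          ring_nf
      _ ≤ ∑ a, Real.exp (s * (g a - μ)) *
            (Fintype.card (Fin N → α) * Real.exp (N * (s ^ 2 / 2))) :=
          sum_le_sum fun a _ => mul_le_mul_of_nonneg_left (hinner a) (Real.exp_pos _).le
      _ ≤ Fintype.card α * Real.exp (s ^ 2 / 2) *
            (Fintype.card (Fin N → α) * Real.exp (N * (s ^ 2 / 2))) := by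
          rw [← sum_mul]
          gcongr
          exact sum_exp_mul_sub_mean_le g hg s
      _ = _ := by
          have : Real.exp (((N + 1 : ℕ) : ℝ) * (s ^ 2 / 2)) =
              Real.exp (s ^ 2 / 2) * Real.exp (N * (s ^ 2 / 2)) := by
            rw [← Real.exp_add]; push_cast; ring_nf
          rw [this]; ring

open Finset in
/-- McDiarmid's exponential moment bound for the uniform distribution on a finite product. -/
theorem sum_exp_mul_sub_mean_le_of_bounded_differences {ι α : Type*} [Fintype ι] [DecidableEq ι]
    [Fintype α] [Nonempty α] (s : ℝ) (f : (ι → α) → ℝ)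
    (hf : ∀ x y i, (∀ j, j ≠ i → x j = y j) → f x - f y ≤ 1) :
    ∑ x, Real.exp (s * (f x - (∑ y, f y) / Fintype.card (ι → α))) ≤
      Fintype.card (ι → α) * Real.exp (Fintype.card ι * (s ^ 2 / 2)) := by
  let e : (Fin (Fintype.card ι) → α) ≃ (ι → α) :=
    Equiv.arrowCongr (Fintype.equivFin ι).symm (Equiv.refl α)
  have h := sum_exp_mul_sub_mean_le_of_bounded_differences_fin s (Fintype.card ι)
    (fun x => f (e x)) fun x y i hxy => hf _ _ ((Fintype.equivFin ι).symm i) fun j hj =>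
      hxy _ fun h => hj (by rw [← h]; simp)
  rw [e.sum_comp f, Fintype.card_congr e,
    e.sum_comp fun x => Real.exp (s * (f x - (∑ y, f y) / Fintype.card (ι → α)))] at h
  exact h

open Finset in
/-- McDiarmid's inequality for the uniform distribution on a finite product. -/
theorem card_filter_mean_add_lt_le {ι α : Type*} [Fintype ι] [DecidableEq ι]
    [Fintype α] [Nonempty α] {s : ℝ} (hs : 0 ≤ s) (r : ℝ) (f : (ι → α) → ℝ)
    (hf : ∀ x y i, (∀ j, j ≠ i → x j = y j) → f x - f y ≤ 1)
    {μ : ℝ} (hμ : (∑ y, f y) / Fintype.card (ι → α) = μ) [DecidablePred fun x => μ + r < f x] :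
    (#{x | μ + r < f x} : ℝ) ≤
      Fintype.card (ι → α) * Real.exp (Fintype.card ι * (s ^ 2 / 2) - s * r) := by
  have h := sum_exp_mul_sub_mean_le_of_bounded_differences s f hf
  rw [hμ] at h
  have hmarkov : (#{x | μ + r < f x} : ℝ) * Real.exp (s * r) ≤
      ∑ x, Real.exp (s * (f x - μ)) := by
    rw [← nsmul_eq_mul, ← sum_const]
    refine (sum_le_sum fun x hx => ?_).trans
      (sum_le_sum_of_subset_of_nonneg (filter_subset _ univ) fun _ _ _ => (Real.exp_pos _).le)
    rw [mem_filter] at hx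
    gcongr
    linarith [hx.2]
  rw [Real.exp_sub, ← mul_div_assoc, le_div_iff₀ (Real.exp_pos _)]
  exact hmarkov.trans h

open Finset in
theorem card_filter_comp_injective {ι κ A : Type*} [Fintype ι] [Fintype κ] [DecidableEq ι]
    [DecidableEq κ] [Fintype A] {φ : ι → κ} (hφ : Function.Injective φ)
    (P : (ι → A) → Prop) [DecidablePred P] [DecidablePred fun C : κ → A => P (C ∘ φ)] :
    #{C : κ → A | P (C ∘ φ)} * Fintype.card (ι → A) =
      #{X | P X} * Fintype.card (κ → A) := by
  classical
  let e : (κ → A) ≃ (ι → A) × ({j // ¬ j ∈ Set.range φ} → A) :=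
    (Equiv.piEquivPiSubtypeProd (· ∈ Set.range φ) fun _ => A).trans
      ((Equiv.arrowCongr (Equiv.ofInjective φ hφ).symm (Equiv.refl A)).prodCongr (Equiv.refl _))
  have he : ∀ C, (e C).1 = C ∘ φ := fun C => rfl
  have hcard : #{C : κ → A | P (C ∘ φ)} =
      #{X | P X} * Fintype.card ({j // ¬ j ∈ Set.range φ} → A) := by
    rw [← card_univ, ← card_product]
    exact card_equiv e fun C => by simp [← he]
  rw [hcard, Fintype.card_congr e, Fintype.card_prod]
  ring

open Finset Classical in
theorem card_filter_expLCS_add_lt_le {k d : ℕ} (hk : 0 < k) (hd : 0 < d) {s : ℝ} (hs : 0 ≤ s)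
    (n : ℕ) (r : ℝ) :
    (#{X : Fin d → Fin n → Fin k |
        expLCS k d n + r < (lcsLen d (fun i => List.ofFn (X i)) : ℝ)} : ℝ) ≤
      Fintype.card (Fin d → Fin n → Fin k) * Real.exp (d * n * (s ^ 2 / 2) - s * r) := by
  have : NeZero k := ⟨hk.ne'⟩
  let e : (Fin d × Fin n → Fin k) ≃ (Fin d → Fin n → Fin k) := Equiv.curry _ _ _
  let f : (Fin d → Fin n → Fin k) → ℝ := fun X => (lcsLen d (fun i => List.ofFn (X i)) : ℝ)
  have hmean : (∑ y, f (e y)) / Fintype.card (Fin d × Fin n → Fin k) = expLCS k d n := by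
    rw [e.sum_comp f, Fintype.card_congr e]; rfl
  have hdiff : ∀ x y i, (∀ j, j ≠ i → x j = y j) → f (e x) - f (e y) ≤ 1 := fun x y i hxy => by
    have hle : lcsLen d (fun j => List.ofFn (e x j)) ≤
        lcsLen d (fun j => List.ofFn (e y j)) + 1 :=
      lcsLen_le_add_one hd i.1 i.2
        (List.eraseIdx_ofFn_congr i.2 fun t ht => hxy (i.1, t) fun h => ht (congrArg Prod.snd h))
        fun j hj => congrArg List.ofFn <| funext fun t =>
          hxy (j, t) fun h => hj (congrArg Prod.fst h)
    rw [sub_le_iff_le_add']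
    simp only [f]
    exact_mod_cast hle
  have hcard : #{x | expLCS k d n + r < f (e x)} = #{X | expLCS k d n + r < f X} :=
    card_equiv e fun x => by simp
  have h := card_filter_mean_add_lt_le hs r (fun x => f (e x)) hdiff hmean
  rw [hcard, Fintype.card_congr e, Fintype.card_prod, Fintype.card_fin, Fintype.card_fin] at h
  push_cast at h ⊢
  exact h

open Finset Classical in
theorem card_filter_exists_expLCS_add_lt_div_le {k d : ℕ} (hk : 0 < k) (hd : 0 < d) {s : ℝ}
    (hs : 0 ≤ s) (n M : ℕ) (r : ℝ) :
    (#{C : Fin M → Fin n → Fin k | ∃ ι : Fin d → Fin M, StrictMono ι ∧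
        expLCS k d n + r < (lcsLen d (fun j => List.ofFn (C (ι j))) : ℝ)} : ℝ) /
      Fintype.card (Fin M → Fin n → Fin k) ≤
    (M : ℝ) ^ d * Real.exp (d * n * (s ^ 2 / 2) - s * r) := by
  have : NeZero k := ⟨hk.ne'⟩
  have hcM : (0 : ℝ) < Fintype.card (Fin M → Fin n → Fin k) := by exact_mod_cast Fintype.card_pos
  have hcd : (0 : ℝ) < Fintype.card (Fin d → Fin n → Fin k) := by exact_mod_cast Fintype.card_pos
  let P : (Fin d → Fin n → Fin k) → Prop := fun X =>
    expLCS k d n + r < (lcsLen d (fun j => List.ofFn (X j)) : ℝ)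
  set B := Real.exp (d * n * (s ^ 2 / 2) - s * r)
  have hone : ∀ ι : Fin d → Fin M, StrictMono ι →
      (#{C : Fin M → Fin n → Fin k | P (C ∘ ι)} : ℝ) ≤
        Fintype.card (Fin M → Fin n → Fin k) * B := by
    intro ι hι
    have h₁ : (#{C : Fin M → Fin n → Fin k | P (C ∘ ι)} : ℝ) *
        Fintype.card (Fin d → Fin n → Fin k) =
        #{X | P X} * Fintype.card (Fin M → Fin n → Fin k) := by
      exact_mod_cast card_filter_comp_injective hι.injective P
    have h₂ : (#{X | P X} : ℝ) ≤ Fintype.card (Fin d → Fin n → Fin k) * B :=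
      card_filter_expLCS_add_lt_le hk hd hs n r
    refine le_of_mul_le_mul_right ?_ hcd
    rw [h₁]
    calc _ ≤ Fintype.card (Fin d → Fin n → Fin k) * B *
          Fintype.card (Fin M → Fin n → Fin k) := by gcongr
      _ = _ := by ring
  have hunion : ({C : Fin M → Fin n → Fin k | ∃ ι : Fin d → Fin M, StrictMono ι ∧
        expLCS k d n + r < (lcsLen d (fun j => List.ofFn (C (ι j))) : ℝ)} : Finset _) ⊆
      ({ι : Fin d → Fin M | StrictMono ι} : Finset _).biUnion fun ι =>
        {C : Fin M → Fin n → Fin k | P (C ∘ ι)} := by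
    intro C hC
    obtain ⟨ι, hι, h⟩ := (mem_filter.mp hC).2
    exact mem_biUnion.mpr ⟨ι, by simpa using hι, by simpa [P] using h⟩
  rw [div_le_iff₀ hcM]
  calc _ ≤ ((∑ ι : Fin d → Fin M with StrictMono ι,
          #{C : Fin M → Fin n → Fin k | P (C ∘ ι)} : ℕ) : ℝ) := by
        exact_mod_cast (card_le_card hunion).trans card_biUnion_le
    _ ≤ ∑ ι : Fin d → Fin M with StrictMono ι, Fintype.card (Fin M → Fin n → Fin k) * B := by
        rw [Nat.cast_sum]
        exact sum_le_sum fun ι hι => hone ι (mem_filter.mp hι).2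
    _ = (#{ι : Fin d → Fin M | StrictMono ι} : ℝ) *
          (Fintype.card (Fin M → Fin n → Fin k) * B) := by
        rw [sum_const, nsmul_eq_mul]
    _ ≤ (M : ℝ) ^ d * (Fintype.card (Fin M → Fin n → Fin k) * B) := by
        gcongr
        have h : #{ι : Fin d → Fin M | StrictMono ι} ≤ M ^ d := by
          simpa using card_filter_le (univ : Finset (Fin d → Fin M)) StrictMono
        exact_mod_cast h
    _ = _ := by ring

theorem natCeil_two_rpow_le {x : ℝ} (hx : 0 ≤ x) :
    (⌈(2 : ℝ) ^ x⌉₊ : ℝ) ≤ 2 * Real.exp x := by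
  have h₁ : (2 : ℝ) ^ x ≤ Real.exp x := by
    rw [Real.rpow_def_of_pos two_pos]
    exact Real.exp_le_exp.mpr (mul_le_of_le_one_left hx (by linarith [Real.log_two_lt_d9]))
  linarith [Nat.ceil_lt_add_one (Real.rpow_nonneg two_pos.le x : (0 : ℝ) ≤ 2 ^ x),
    Real.one_le_exp hx]

open Classical in
/-- Random codes are list-decodable against deletions: for fixed `k ≥ 2`, `d ≥ 2` and
`ε > 0`, there is a rate `c > 0` such that for `M = ⌈2^{c·n}⌉` independent uniformly
random codewords in `[k]^n`, the probability that some `d` of them (with indices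
`i₁ < ⋯ < i_d`) have LCS exceeding `E[LCS(X¹,…,X^d)] + ε·n` tends to `0` as `n → ∞`. -/
theorem random_code_list_decodable (k d : ℕ) (hk : 2 ≤ k) (hd : 2 ≤ d)
    (ε : ℝ) (hε : 0 < ε) :
    ∃ c : ℝ, 0 < c ∧
      Filter.Tendsto
        (fun n : ℕ =>
          ((Finset.univ.filter
            (fun C : Fin ⌈(2 : ℝ) ^ (c * n)⌉₊ → Fin n → Fin k =>
              ∃ ι : Fin d → Fin ⌈(2 : ℝ) ^ (c * n)⌉₊, StrictMono ι ∧
                expLCS k d n + ε * n <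
                  (lcsLen d (fun j => List.ofFn (C (ι j))) : ℝ))).card : ℝ) /
            (Fintype.card (Fin ⌈(2 : ℝ) ^ (c * n)⌉₊ → Fin n → Fin k) : ℝ))
        Filter.atTop (nhds 0) := by
  have hd₀ : 0 < d := by omega
  have hdpos : (0 : ℝ) < d := by exact_mod_cast hd₀
  refine ⟨ε ^ 2 / (4 * d ^ 2), by positivity, ?_⟩
  have hlim : Filter.Tendsto (fun n : ℕ => (2 : ℝ) ^ d * Real.exp (-(ε ^ 2 / (4 * d)) * n))
      Filter.atTop (nhds 0) := by
    rw [← mul_zero ((2 : ℝ) ^ d)]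
    refine Filter.Tendsto.const_mul _ (Real.tendsto_exp_atBot.comp ?_)
    exact tendsto_natCast_atTop_atTop.const_mul_atTop_of_neg (neg_neg_of_pos (by positivity))
  refine squeeze_zero (fun n => by positivity) (fun n => ?_) hlim
  refine (card_filter_exists_expLCS_add_lt_div_le (by omega) hd₀ (s := ε / d) (by positivity) n _
    (ε * n)).trans ?_
  calc _ ≤ (2 * Real.exp (ε ^ 2 / (4 * d ^ 2) * n)) ^ d *
        Real.exp (d * n * ((ε / d) ^ 2 / 2) - ε / d * (ε * n)) := by
        gcongr
        exact natCeil_two_rpow_le (by positivity)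
    _ = _ := by
        rw [mul_pow, ← Real.exp_nat_mul, mul_assoc, ← Real.exp_add]
        congr 2
        field_simp
        ring
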